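/- Let X be a nonempty finite type, p a probability mass function on X with full support, and E : X → ℝ. Write μ = Σ_x p(x)·exp(−E(x)), A = log μ, and μ₂ = Σ_x p(x)·exp(−2E(x)) − μ². For i.i.d. random variables X_1, X_2, … with law p, T_n = log((1/n)·Σ_{i=1}^n exp(−E(X_i))), and U_n = (2n−1)·T_n − 2(n−1)·T_{n−1}, one has lim_{n→∞} n·(𝔼[U_n] − A) = μ₂/(2μ²). -/

import Mathlib

open Finset

/-- The `k`-th moment of `∑ i, y (X i)` for `n` independent draws `X i` with weights `p`. -/
noncomputable def sumMoment {X : Type*} [Fintype X] (p y : X → ℝ) (k n : ℕ) : ℝ :=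
  ∑ ω : Fin n → X, (∏ i, p (ω i)) * (∑ i, y (ω i)) ^ k

theorem sum_prod_weight {X : Type*} [Fintype X] {p : X → ℝ} (hsum : ∑ x, p x = 1) (n : ℕ) :
    ∑ ω : Fin n → X, ∏ i, p (ω i) = 1 := by
  classical
  rw [← Fintype.piFinset_univ, ← Finset.prod_univ_sum]
  simp [hsum]

theorem sumMoment_zero_right {X : Type*} [Fintype X] (p y : X → ℝ) {k : ℕ} (hk : k ≠ 0) :
    sumMoment p y k 0 = 0 := by
  simp [sumMoment, hk]

theorem sumMoment_zero_left {X : Type*} [Fintype X] {p : X → ℝ} (hsum : ∑ x, p x = 1)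
    (y : X → ℝ) (n : ℕ) : sumMoment p y 0 n = 1 := by
  simpa [sumMoment] using sum_prod_weight hsum n

theorem sumMoment_succ {X : Type*} [Fintype X] (p y : X → ℝ) (k n : ℕ) :
    sumMoment p y k (n + 1) = ∑ j ∈ range (k + 1),
      (k.choose j : ℝ) * (∑ x, p x * y x ^ j) * sumMoment p y (k - j) n := by
  have hexp : ∀ (x : X) (ω : Fin n → X), p x * (∏ i, p (ω i)) * (y x + ∑ i, y (ω i)) ^ k =
      ∑ j ∈ range (k + 1), (k.choose j : ℝ) *
        ((p x * y x ^ j) * ((∏ i, p (ω i)) * (∑ i, y (ω i)) ^ (k - j))) := by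
    intro x ω
    rw [add_pow, Finset.mul_sum]
    exact Finset.sum_congr rfl fun j _ => by ring
  unfold sumMoment
  rw [← (Fin.consEquiv fun _ : Fin (n + 1) => X).sum_comp, Fintype.sum_prod_type]
  simp only [Fin.consEquiv_apply, Fin.prod_univ_succ, Fin.sum_univ_succ, Fin.cons_zero,
    Fin.cons_succ, hexp]
  simp_rw [mul_assoc (Nat.cast _ : ℝ), Finset.sum_mul_sum, Finset.mul_sum (s := univ)]
  rw [Finset.sum_comm (s := range (k + 1))]
  exact Finset.sum_congr rfl fun x _ => Finset.sum_comm

section Moments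

variable {X : Type*} [Fintype X] {p y : X → ℝ}

theorem sumMoment_one (hsum : ∑ x, p x = 1) (hy : ∑ x, p x * y x = 0) (n : ℕ) :
    sumMoment p y 1 n = 0 := by
  induction n with
  | zero => simp [sumMoment_zero_right]
  | succ n ih =>
    simp [sumMoment_succ, sum_range_succ, sumMoment_zero_left, hsum, hy, ih]

theorem sumMoment_two (hsum : ∑ x, p x = 1) (hy : ∑ x, p x * y x = 0) (n : ℕ) :
    sumMoment p y 2 n = n * ∑ x, p x * y x ^ 2 := by
  induction n with
  | zero => simp [sumMoment_zero_right]
  | succ n ih =>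
    simp [sumMoment_succ, sum_range_succ, sumMoment_zero_left, hsum, hy, ih]
    ring

theorem sumMoment_three (hsum : ∑ x, p x = 1) (hy : ∑ x, p x * y x = 0) (n : ℕ) :
    sumMoment p y 3 n = n * ∑ x, p x * y x ^ 3 := by
  induction n with
  | zero => simp [sumMoment_zero_right]
  | succ n ih =>
    simp [sumMoment_succ, sum_range_succ, sumMoment_zero_left, hsum, hy, ih,
      sumMoment_one hsum hy]
    ring

theorem sumMoment_four (hsum : ∑ x, p x = 1) (hy : ∑ x, p x * y x = 0) (n : ℕ) :
    sumMoment p y 4 n = n * ∑ x, p x * y x ^ 4 +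
      3 * n * (n - 1) * (∑ x, p x * y x ^ 2) ^ 2 := by
  induction n with
  | zero => simp [sumMoment_zero_right]
  | succ n ih =>
    simp [sumMoment_succ, sum_range_succ, sumMoment_zero_left, hsum, hy, ih,
      sumMoment_one hsum hy, sumMoment_two hsum hy, Nat.choose]
    ring

theorem sumMoment_five (hsum : ∑ x, p x = 1) (hy : ∑ x, p x * y x = 0) (n : ℕ) :
    sumMoment p y 5 n = n * ∑ x, p x * y x ^ 5 +
      10 * n * (n - 1) * ((∑ x, p x * y x ^ 2) * ∑ x, p x * y x ^ 3) := by
  induction n with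
  | zero => simp [sumMoment_zero_right]
  | succ n ih =>
    simp [sumMoment_succ, sum_range_succ, sumMoment_zero_left, hsum, hy, ih,
      sumMoment_one hsum hy, sumMoment_two hsum hy, sumMoment_three hsum hy, Nat.choose]
    ring

theorem sumMoment_six (hsum : ∑ x, p x = 1) (hy : ∑ x, p x * y x = 0) (n : ℕ) :
    sumMoment p y 6 n = n * ∑ x, p x * y x ^ 6 +
      n * (n - 1) * (15 * (∑ x, p x * y x ^ 2) * (∑ x, p x * y x ^ 4) +
        10 * (∑ x, p x * y x ^ 3) ^ 2) +
      15 * n * (n - 1) * (n - 2) * (∑ x, p x * y x ^ 2) ^ 3 := by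
  induction n with
  | zero => simp [sumMoment_zero_right]
  | succ n ih =>
    simp [sumMoment_succ, sum_range_succ, sumMoment_zero_left, hsum, hy, ih,
      sumMoment_one hsum hy, sumMoment_two hsum hy, sumMoment_three hsum hy,
      sumMoment_four hsum hy, Nat.choose]
    ring

end Moments

theorem abs_log_one_add_sub_le {δ t : ℝ} (hδ : 0 < δ) (hδ1 : δ ≤ 1) (ht : δ ≤ 1 + t) :
    |Real.log (1 + t) - (t - t ^ 2 / 2 + t ^ 3 / 3 - t ^ 4 / 4 + t ^ 5 / 5)| ≤ t ^ 6 / δ := by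
  have key : ∀ ξ ∈ Set.uIcc 0 t, δ ≤ 1 + ξ ∧ |ξ| ≤ |t| := by
    intro ξ hξ
    rcases Set.mem_uIcc.1 hξ with h | h
    · exact ⟨by linarith, abs_le_abs_of_nonneg h.1 h.2⟩
    · exact ⟨by linarith, abs_le_abs_of_nonpos h.2 h.1⟩
  have hd : ∀ ξ ∈ Set.uIcc 0 t, HasDerivWithinAt
      (fun t => Real.log (1 + t) - (t - t ^ 2 / 2 + t ^ 3 / 3 - t ^ 4 / 4 + t ^ 5 / 5))
      (-ξ ^ 5 / (1 + ξ)) (Set.uIcc 0 t) ξ := by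
    intro ξ hξ
    have h0 : 1 + ξ ≠ 0 := by linarith [(key ξ hξ).1]
    have hid := hasDerivAt_id' ξ
    have h := (((hid.const_add 1).log h0).sub
      (((((hid.sub ((hid.pow 2).div_const 2)).add ((hid.pow 3).div_const 3)).sub
        ((hid.pow 4).div_const 4)).add ((hid.pow 5).div_const 5)))).hasDerivWithinAt
          (s := Set.uIcc 0 t)
    refine h.congr_deriv ?_
    push_cast
    field_simp
    ring
  have hb : ∀ ξ ∈ Set.uIcc 0 t, ‖-ξ ^ 5 / (1 + ξ)‖ ≤ |t| ^ 5 / δ := by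
    intro ξ hξ
    obtain ⟨h1, h2⟩ := key ξ hξ
    rw [Real.norm_eq_abs, abs_div, abs_neg, abs_pow, abs_of_pos (hδ.trans_le h1)]
    gcongr
  have h := (convex_uIcc 0 t).norm_image_sub_le_of_norm_hasDerivWithin_le hd hb
    Set.left_mem_uIcc Set.right_mem_uIcc
  have h6 : |t| ^ 5 / δ * |t| = t ^ 6 / δ := by
    rw [div_mul_eq_mul_div, ← pow_succ, Even.pow_abs (by decide)]
  simpa [h6] using h

theorem exists_log_mean_expansion {X : Type*} [Fintype X] {p y : X → ℝ} (hp : ∀ x, 0 ≤ p x)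
    (hsum : ∑ x, p x = 1) (hy : ∑ x, p x * y x = 0) {δ : ℝ} (hδ : 0 < δ) (hδ1 : δ ≤ 1)
    (hyδ : ∀ x, δ ≤ 1 + y x) :
    ∃ c K : ℝ, ∀ n : ℕ, 0 < n →
      |(∑ ω : Fin n → X, (∏ i, p (ω i)) * Real.log (1 + (∑ i, y (ω i)) / n)) -
        (-(∑ x, p x * y x ^ 2) / 2 / n + c / n ^ 2)| ≤ K / n ^ 3 := by
  set m₂ := ∑ x, p x * y x ^ 2 with hm₂
  set m₃ := ∑ x, p x * y x ^ 3 with hm₃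
  set m₄ := ∑ x, p x * y x ^ 4 with hm₄
  set m₅ := ∑ x, p x * y x ^ 5 with hm₅
  set m₆ := ∑ x, p x * y x ^ 6 with hm₆
  let P : ℝ → ℝ := fun s => -(m₄ - 3 * m₂ ^ 2) / 4 + (m₅ * s + 10 * (m₂ * m₃) * (1 - s)) / 5
  let Q : ℝ → ℝ := fun s => (m₆ * s ^ 2 + (15 * m₂ * m₄ + 10 * m₃ ^ 2) * (s - s ^ 2) +
    15 * m₂ ^ 3 * (1 - 3 * s + 2 * s ^ 2)) / δ
  obtain ⟨K, hK⟩ := (isCompact_Icc (a := (0 : ℝ)) (b := 1)).exists_bound_of_continuousOn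
    (f := fun s => |P s| + Q s) (by fun_prop)
  refine ⟨m₃ / 3 - 3 * m₂ ^ 2 / 4, K, fun n hn => ?_⟩
  have hn' : (0 : ℝ) < n := by exact_mod_cast hn
  have hn1 : (1 : ℝ) ≤ n := by exact_mod_cast hn
  have hmom : ∀ k, ∑ ω : Fin n → X, (∏ i, p (ω i)) * ((∑ i, y (ω i)) / n) ^ k =
      sumMoment p y k n / n ^ k := by
    intro k
    rw [sumMoment, Finset.sum_div]
    exact Finset.sum_congr rfl fun ω _ => by rw [div_pow, mul_div_assoc]
  have hmean : ∀ ω : Fin n → X, δ ≤ 1 + (∑ i, y (ω i)) / n := by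
    intro ω
    have h := Finset.card_nsmul_le_sum univ (fun i => 1 + y (ω i)) δ fun i _ => hyδ _
    simp only [card_univ, Fintype.card_fin, nsmul_eq_mul, sum_add_distrib, sum_const,
      mul_one] at h
    rw [← sub_le_iff_le_add', le_div_iff₀ hn']
    linarith
  have hrem : |∑ ω : Fin n → X, (∏ i, p (ω i)) * (Real.log (1 + (∑ i, y (ω i)) / n) -
      ((∑ i, y (ω i)) / n - ((∑ i, y (ω i)) / n) ^ 2 / 2 + ((∑ i, y (ω i)) / n) ^ 3 / 3 -
        ((∑ i, y (ω i)) / n) ^ 4 / 4 + ((∑ i, y (ω i)) / n) ^ 5 / 5))| ≤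
      sumMoment p y 6 n / n ^ 6 / δ := by
    rw [← hmom, Finset.sum_div]
    refine (Finset.abs_sum_le_sum_abs _ _).trans (Finset.sum_le_sum fun ω _ => ?_)
    have hw : 0 ≤ ∏ i, p (ω i) := Finset.prod_nonneg fun i _ => hp _
    rw [abs_mul, abs_of_nonneg hw, mul_div_assoc]
    exact mul_le_mul_of_nonneg_left (abs_log_one_add_sub_le hδ hδ1 (hmean ω)) hw
  have hexpand : ∑ ω : Fin n → X, (∏ i, p (ω i)) * (Real.log (1 + (∑ i, y (ω i)) / n) -
      ((∑ i, y (ω i)) / n - ((∑ i, y (ω i)) / n) ^ 2 / 2 + ((∑ i, y (ω i)) / n) ^ 3 / 3 -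
        ((∑ i, y (ω i)) / n) ^ 4 / 4 + ((∑ i, y (ω i)) / n) ^ 5 / 5)) =
      (∑ ω : Fin n → X, (∏ i, p (ω i)) * Real.log (1 + (∑ i, y (ω i)) / n)) -
        (sumMoment p y 1 n / n ^ 1 - sumMoment p y 2 n / n ^ 2 / 2 +
          sumMoment p y 3 n / n ^ 3 / 3 - sumMoment p y 4 n / n ^ 4 / 4 +
          sumMoment p y 5 n / n ^ 5 / 5) := by
    simp only [← hmom, Finset.sum_div (s := (univ : Finset (Fin n → X))),
      ← Finset.sum_sub_distrib, ← Finset.sum_add_distrib]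
    exact Finset.sum_congr rfl fun ω _ => by ring
  rw [hexpand, sumMoment_one hsum hy, sumMoment_two hsum hy, sumMoment_three hsum hy,
    sumMoment_four hsum hy, sumMoment_five hsum hy, sumMoment_six hsum hy] at hrem
  simp only [← hm₂, ← hm₃, ← hm₄, ← hm₅, ← hm₆] at hrem
  have hKn := (le_abs_self _).trans (hK (1 / n) ⟨by positivity, (div_le_one hn').2 hn1⟩)
  set L := ∑ ω : Fin n → X, (∏ i, p (ω i)) * Real.log (1 + (∑ i, y (ω i)) / n)
  have hpoly : (0 : ℝ) / n ^ 1 - n * m₂ / n ^ 2 / 2 + n * m₃ / n ^ 3 / 3 -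
      (n * m₄ + 3 * n * (n - 1) * m₂ ^ 2) / n ^ 4 / 4 +
      (n * m₅ + 10 * n * (n - 1) * (m₂ * m₃)) / n ^ 5 / 5 =
      (-m₂ / 2 / n + (m₃ / 3 - 3 * m₂ ^ 2 / 4) / n ^ 2) + P (1 / n) / n ^ 3 := by
    simp only [P]
    field_simp
    ring
  have hsix : (n * m₆ + n * (n - 1) * (15 * m₂ * m₄ + 10 * m₃ ^ 2) +
      15 * n * (n - 1) * (n - 2) * m₂ ^ 3) / n ^ 6 / δ = Q (1 / n) / n ^ 3 := by
    simp only [Q]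
    field_simp
    ring
  rw [hpoly, hsix, ← sub_sub] at hrem
  calc _ ≤ Q (1 / n) / n ^ 3 + |P (1 / n) / n ^ 3| :=
        sub_le_iff_le_add.1 ((abs_sub_abs_le_abs_sub _ _).trans hrem)
    _ = (|P (1 / n)| + Q (1 / n)) / n ^ 3 := by
        rw [abs_div, abs_of_pos (by positivity : (0 : ℝ) < n ^ 3)]
        ring
    _ ≤ K / n ^ 3 := by gcongr

theorem tendsto_mul_corrected_sub {a A c K : ℝ} {e u : ℕ → ℝ}
    (he : ∀ n : ℕ, 0 < n → |e n - A - (-a / n + c / n ^ 2)| ≤ K / n ^ 3)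
    (hu : ∀ n : ℕ, 2 ≤ n → u n = (2 * (n : ℝ) - 1) * e n - 2 * ((n : ℝ) - 1) * e (n - 1)) :
    Filter.Tendsto (fun n : ℕ => (n : ℝ) * (u n - A)) Filter.atTop (nhds a) := by
  rw [← Filter.tendsto_add_atTop_iff_nat 2]
  have hlim : Filter.Tendsto (fun n : ℕ => (3 * |c| + 6 * K) * (1 / ((n : ℝ) + 1)))
      Filter.atTop (nhds 0) := by
    simpa using tendsto_one_div_add_atTop_nhds_zero_nat.const_mul (3 * |c| + 6 * K)
  rw [tendsto_iff_dist_tendsto_zero]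
  refine squeeze_zero (fun _ => dist_nonneg) (fun n => ?_) hlim
  have h1 := he (n + 1) (by lia)
  have h2 := he (n + 2) (by lia)
  rw [Real.dist_eq, hu (n + 2) (by lia), show n + 2 - 1 = n + 1 by lia]
  push_cast at h1 h2 ⊢
  obtain ⟨m, hm⟩ : ∃ m : ℝ, m = n + 1 := ⟨_, rfl⟩
  have hm1 : 1 ≤ m := by rw [hm]; simp
  rw [show (n : ℝ) + 2 = m + 1 by rw [hm]; ring] at h2 ⊢
  rw [← hm] at h1 ⊢
  set r₁ := e (n + 1) - A - (-a / m + c / m ^ 2) with hr₁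
  set r₂ := e (n + 2) - A - (-a / (m + 1) + c / (m + 1) ^ 2) with hr₂
  have hK : 0 ≤ K := by
    have := (abs_nonneg _).trans h1
    have hm3 : 0 < m ^ 3 := by positivity
    by_contra! hneg
    exact absurd this (not_le.2 (div_neg_of_neg_of_pos hneg hm3))
  have hid : (m + 1) * ((2 * (m + 1) - 1) * e (n + 2) - 2 * (m + 1 - 1) * e (n + 1) - A) - a =
      -(c * (1 / (m + 1) + 2 / m)) + (m + 1) * (2 * m + 1) * r₂ - 2 * (m + 1) * m * r₁ := by
    rw [hr₁, hr₂]
    field_simp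
    ring
  have hc : |c * (1 / (m + 1) + 2 / m)| ≤ 3 * |c| * (1 / m) := by
    rw [abs_mul, abs_of_pos (by positivity : 0 < 1 / (m + 1) + 2 / m)]
    have : 1 / (m + 1) ≤ 1 / m := by gcongr; linarith
    have h3 : 1 / (m + 1) + 2 / m ≤ 3 * (1 / m) := by
      rw [show 2 / m = 2 * (1 / m) by ring]
      linarith
    nlinarith [abs_nonneg c]
  have hb₂ : |(m + 1) * (2 * m + 1) * r₂| ≤ 2 * K * (1 / m) := by
    rw [abs_mul, abs_of_pos (by positivity : 0 < (m + 1) * (2 * m + 1))]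
    calc _ ≤ (m + 1) * (2 * m + 1) * (K / (m + 1) ^ 3) := by gcongr
      _ ≤ 2 * K * (1 / m) := by
        rw [← mul_div_assoc, mul_one_div, div_le_div_iff₀ (by positivity) (by positivity)]
        nlinarith [mul_nonneg hK (by positivity : 0 ≤ (m + 1) * (3 * m + 2))]
  have hb₁ : |2 * (m + 1) * m * r₁| ≤ 4 * K * (1 / m) := by
    rw [abs_mul, abs_of_pos (by positivity : 0 < 2 * (m + 1) * m)]
    calc _ ≤ 2 * (m + 1) * m * (K / m ^ 3) := by gcongr
      _ ≤ 2 * (m + m) * m * (K / m ^ 3) := by gcongr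
      _ = 4 * K * (1 / m) := by
        field_simp
        ring
  rw [hid]
  calc _ ≤ |c * (1 / (m + 1) + 2 / m)| + |(m + 1) * (2 * m + 1) * r₂| +
        |2 * (m + 1) * m * r₁| := by
        refine (abs_sub _ _).trans ?_
        gcongr
        exact (abs_add_le _ _).trans_eq (by rw [abs_neg])
    _ ≤ _ := by linarith


/-- Leading-order bias of the bias-corrected upper estimator
`U_n = (2n-1) T_n - 2(n-1) T_{n-1}`:
`lim_{n→∞} n (𝔼[U_n] - A) = μ₂ / (2 μ²)`. -/
theorem stmt5 {X : Type*} [Fintype X] [Nonempty X]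
    (p : X → ℝ) (hp : ∀ x, 0 < p x) (hsum : ∑ x, p x = 1)
    (E : X → ℝ)
    (μ μ₂ A : ℝ)
    (hμ : μ = ∑ x, p x * Real.exp (-(E x)))
    (hμ₂ : μ₂ = (∑ x, p x * Real.exp (-(2 * E x))) - μ ^ 2)
    (hA : A = Real.log μ)
    (ET : ℕ → ℝ)
    (hET : ∀ n : ℕ, 0 < n →
      ET n = ∑ ω : Fin n → X, (∏ i, p (ω i)) *
        Real.log ((1 / (n : ℝ)) * ∑ i, Real.exp (-(E (ω i)))))
    (EU : ℕ → ℝ)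
    (hEU : ∀ n : ℕ, 2 ≤ n →
      EU n = (2 * (n : ℝ) - 1) * ET n - 2 * ((n : ℝ) - 1) * ET (n - 1)) :
    Filter.Tendsto (fun n : ℕ => (n : ℝ) * (EU n - A)) Filter.atTop
      (nhds (μ₂ / (2 * μ ^ 2))) := by
  have hw : ∀ x, 0 < p x * Real.exp (-(E x)) := fun x => mul_pos (hp x) (Real.exp_pos _)
  have hμ0 : 0 < μ := hμ ▸ Finset.sum_pos (fun x _ => hw x) univ_nonempty
  set y : X → ℝ := fun x => Real.exp (-(E x)) / μ - 1
  have hy : ∑ x, p x * y x = 0 := by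
    simp only [y, mul_sub, mul_one, ← mul_div_assoc, Finset.sum_sub_distrib, ← Finset.sum_div,
      hsum, ← hμ]
    rw [div_self hμ0.ne', sub_self]
  have hvar : ∑ x, p x * y x ^ 2 = μ₂ / μ ^ 2 := by
    have hterm : ∀ x, p x * y x ^ 2 = p x * Real.exp (-(2 * E x)) / μ ^ 2 -
        2 * (p x * Real.exp (-(E x))) / μ + p x := by
      intro x
      rw [show -(2 * E x) = -(E x) + -(E x) by ring, Real.exp_add]
      simp only [y]
      field_simp
      ring
    simp only [hterm, Finset.sum_add_distrib, Finset.sum_sub_distrib, ← Finset.sum_div,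
      ← Finset.mul_sum, hsum, ← hμ, hμ₂]
    field_simp
    ring
  obtain ⟨x₀, hx₀⟩ := Finite.exists_min fun x => Real.exp (-(E x)) / μ
  obtain ⟨c, K, hcK⟩ := exists_log_mean_expansion (y := y) (fun x => (hp x).le) hsum hy
    (δ := min (Real.exp (-(E x₀)) / μ) 1) (lt_min (div_pos (Real.exp_pos _) hμ0) one_pos)
    (min_le_right _ _) fun x => (min_le_left _ _).trans (by simpa [y] using hx₀ x)
  refine tendsto_mul_corrected_sub (c := c) (K := K) (fun n hn => ?_) hEU
  have hn' : (0 : ℝ) < n := by exact_mod_cast hn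
  have hlog : ∀ ω : Fin n → X, Real.log ((1 / (n : ℝ)) * ∑ i, Real.exp (-(E (ω i)))) =
      A + Real.log (1 + (∑ i, y (ω i)) / n) := by
    intro ω
    have : Nonempty (Fin n) := ⟨⟨0, hn⟩⟩
    have hS : 0 < ∑ i, Real.exp (-(E (ω i))) :=
      Finset.sum_pos (fun i _ => Real.exp_pos _) univ_nonempty
    have hmean : 1 + (∑ i, y (ω i)) / n = (1 / (n : ℝ)) * (∑ i, Real.exp (-(E (ω i)))) / μ := by
      simp only [y, Finset.sum_sub_distrib, ← Finset.sum_div, sum_const, card_univ,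
        Fintype.card_fin, nsmul_eq_mul, mul_one]
      field_simp
      ring
    rw [hmean, Real.log_div (by positivity) hμ0.ne', hA]
    ring
  have hETn : ET n - A =
      ∑ ω : Fin n → X, (∏ i, p (ω i)) * Real.log (1 + (∑ i, y (ω i)) / n) := by
    simp only [hET n hn, hlog, mul_add, Finset.sum_add_distrib, ← Finset.sum_mul,
      sum_prod_weight hsum]
    ring
  have h := hcK n hn
  rw [← hETn, hvar] at h
  rwa [show -(μ₂ / (2 * μ ^ 2)) = -(μ₂ / μ ^ 2) / 2 by ring]
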